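/- arXiv:2406.01909 — 5 statements merged into one kernel-verified Lean document; each statement's English description precedes it below -/
import Mathlib

section
/- Suppose the number of training samples in each class is the same, m_1 = ⋯ = m_K, that m ≥ d with d/K an integer, and that the coding precision satisfies ε ≤ (1/6)√(d/m) exp(−1/2) K^{−1/(K−1)} (1 + 1/√K)^{−2m/(K−1)}. If the regularization parameter in the regularized MCR² problem is set as λ = α/(1 + αm/d) − α/(1 + αKm/d) with α = d/(mε²), then the set of global optimal solutions of the constrained MCR² problem (maximize R(Z) − Σ_k (m_k/m) R_c(Z_k) subject to ‖Z_k‖_F² = m_k for all k) is a subset of the set of global optimal solutions of the regularized MCR² problem (maximize F(Z) over ℝ^{d×m}). -/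
open Matrix BigOperators Finset

noncomputable section

/-- The `k`-th block of columns of the feature matrix `Z`. -/
def blk {d K : ℕ} (mk : Fin K → ℕ) (Z : Matrix (Fin d) ((k : Fin K) × Fin (mk k)) ℝ)
    (k : Fin K) : Matrix (Fin d) (Fin (mk k)) ℝ :=
  Matrix.of fun i j => Z i ⟨k, j⟩

/-- Squared Frobenius norm. -/
def frobSq {n m : Type*} [Fintype n] [Fintype m] (A : Matrix n m ℝ) : ℝ :=
  ∑ i, ∑ j, A i j ^ 2

/-- The (lossy) coding rate `(1/2) log det (I + a • A * Aᵀ)`. -/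
def codingRate {d : ℕ} {n : Type*} [Fintype n] (a : ℝ) (A : Matrix (Fin d) n ℝ) : ℝ :=
  (1 / 2) * Real.log ((1 + a • (A * Aᵀ)).det)

/-- Total number of samples `m = ∑ k, m_k`. -/
def mTot {K : ℕ} (mk : Fin K → ℕ) : ℕ := ∑ k, mk k

/-- `α = d / (m ε²)`. -/
def alph (d : ℕ) {K : ℕ} (mk : Fin K → ℕ) (ε : ℝ) : ℝ :=
  (d : ℝ) / ((mTot mk : ℝ) * ε ^ 2)

/-- `α_k = d / (m_k ε²)`. -/
def alphK (d : ℕ) {K : ℕ} (mk : Fin K → ℕ) (ε : ℝ) (k : Fin K) : ℝ :=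
  (d : ℝ) / ((mk k : ℝ) * ε ^ 2)

/-- The regularized MCR² objective
`F(Z) = R(Z) − ∑ k (m_k/m) R_c(Z_k) − (λ/2) ‖Z‖_F²`. -/
def mcr2F (d K : ℕ) (mk : Fin K → ℕ) (ε lam : ℝ)
    (Z : Matrix (Fin d) ((k : Fin K) × Fin (mk k)) ℝ) : ℝ :=
  codingRate (alph d mk ε) Z
    - ∑ k, ((mk k : ℝ) / (mTot mk : ℝ)) * codingRate (alphK d mk ε k) (blk mk Z k)
    - (lam / 2) * frobSq Z

/-- The first-order (criticality) condition `∇F(Z) = 0`, i.e.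
`α (I + α Z Zᵀ)⁻¹ Z_k − α (I + α_k Z_k Z_kᵀ)⁻¹ Z_k − λ Z_k = 0` for all `k`. -/
def IsCriticalPt (d K : ℕ) (mk : Fin K → ℕ) (ε lam : ℝ)
    (Z : Matrix (Fin d) ((k : Fin K) × Fin (mk k)) ℝ) : Prop :=
  ∀ k : Fin K,
    alph d mk ε • ((1 + alph d mk ε • (Z * Zᵀ))⁻¹ * blk mk Z k)
      - alph d mk ε • ((1 + alphK d mk ε k • (blk mk Z k * (blk mk Z k)ᵀ))⁻¹ * blk mk Z k)
      - lam • blk mk Z k = 0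

/-- Second derivative of `f` at `Z` along direction `D`, `∇²f(Z)[D,D]`. -/
def hessAlong {d K : ℕ} {mk : Fin K → ℕ}
    (f : Matrix (Fin d) ((k : Fin K) × Fin (mk k)) ℝ → ℝ)
    (Z D : Matrix (Fin d) ((k : Fin K) × Fin (mk k)) ℝ) : ℝ :=
  iteratedDeriv 2 (fun t : ℝ => f (Z + t • D)) 0

/-- Upper bound for the regularization parameter:
`d (√(m/m_max) − 1) / (m (√(m/m_max) + 1) ε²)`. -/
def lamBound (d : ℕ) {K : ℕ} (mk : Fin K → ℕ) (ε : ℝ) : ℝ :=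
  (d : ℝ) * (Real.sqrt ((mTot mk : ℝ) / ((Finset.univ.sup mk : ℕ) : ℝ)) - 1) /
    ((mTot mk : ℝ) * (Real.sqrt ((mTot mk : ℝ) / ((Finset.univ.sup mk : ℕ) : ℝ)) + 1) * ε ^ 2)

/-- `η_k = (α_k − α) − λ (m/m_k + 1)`. -/
def etaK (d : ℕ) {K : ℕ} (mk : Fin K → ℕ) (ε lam : ℝ) (k : Fin K) : ℝ :=
  (alphK d mk ε k - alph d mk ε) - lam * ((mTot mk : ℝ) / (mk k : ℝ) + 1)

/-- `σ̄_k = ((η_k + √(η_k² − 4λ²m/m_k)) / (2λα_k))^(1/2)`. -/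
def sigBar (d : ℕ) {K : ℕ} (mk : Fin K → ℕ) (ε lam : ℝ) (k : Fin K) : ℝ :=
  Real.sqrt ((etaK d mk ε lam k
      + Real.sqrt (etaK d mk ε lam k ^ 2 - 4 * lam ^ 2 * ((mTot mk : ℝ) / (mk k : ℝ))))
    / (2 * lam * alphK d mk ε k))

/-- `σ̲_k = ((η_k − √(η_k² − 4λ²m/m_k)) / (2λα_k))^(1/2)`. -/
def sigUnd (d : ℕ) {K : ℕ} (mk : Fin K → ℕ) (ε lam : ℝ) (k : Fin K) : ℝ :=
  Real.sqrt ((etaK d mk ε lam k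
      - Real.sqrt (etaK d mk ε lam k ^ 2 - 4 * lam ^ 2 * ((mTot mk : ℝ) / (mk k : ℝ))))
    / (2 * lam * alphK d mk ε k))


/-- Upper bound on the coding precision `ε`:
`(1/6) √(d/m) exp(−1/2) K^(−1/(K−1)) (1 + 1/√K)^(−2m/(K−1))`. -/
def epsBound (d : ℕ) {K : ℕ} (mk : Fin K → ℕ) : ℝ :=
  (1 / 6) * Real.sqrt ((d : ℝ) / (mTot mk : ℝ)) * Real.exp (-(1 / 2)) *
    (K : ℝ) ^ (-(1 : ℝ) / ((K : ℝ) - 1)) *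
    (1 + 1 / Real.sqrt (K : ℝ)) ^ (-(2 * (mTot mk : ℝ)) / ((K : ℝ) - 1))

/-- `Z` is a global optimal solution of the constrained MCR² problem:
maximize `R(Z) − ∑ k (m_k/m) R_c(Z_k)` subject to `‖Z_k‖_F² = m_k` for all `k`. -/
def IsConstrainedGlobalMax (d K : ℕ) (mk : Fin K → ℕ) (ε : ℝ)
    (Z : Matrix (Fin d) ((k : Fin K) × Fin (mk k)) ℝ) : Prop :=
  (∀ k, frobSq (blk mk Z k) = (mk k : ℝ)) ∧
  ∀ W : Matrix (Fin d) ((k : Fin K) × Fin (mk k)) ℝ,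
    (∀ k, frobSq (blk mk W k) = (mk k : ℝ)) → mcr2F d K mk ε 0 W ≤ mcr2F d K mk ε 0 Z

/-! ### Determinant inequalities -/

lemma det_one_add_smul_eq_prod {d : ℕ} {A : Matrix (Fin d) (Fin d) ℝ} (hA : A.IsHermitian)
    (a : ℝ) : (1 + a • A).det = ∏ i, (1 + a * hA.eigenvalues i) := by
  set U : Matrix (Fin d) (Fin d) ℝ := (hA.eigenvectorUnitary).1
  have hUU : U * star U = 1 := Unitary.coe_mul_star_self hA.eigenvectorUnitary
  have hUU' : star U * U = 1 := Unitary.coe_star_mul_self hA.eigenvectorUnitary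
  have hspec : A = U * diagonal hA.eigenvalues * star U := by
    have h := hA.spectral_theorem
    rw [Unitary.conjStarAlgAut_apply] at h
    exact h
  have h1 : 1 + a • A = U * diagonal (fun i => 1 + a * hA.eigenvalues i) * star U := by
    have h2 : diagonal (fun i => 1 + a * hA.eigenvalues i)
        = (1 : Matrix (Fin d) (Fin d) ℝ) + a • diagonal hA.eigenvalues := by
      rw [← diagonal_one, ← diagonal_smul, diagonal_add]
      rfl
    rw [h2, Matrix.mul_add, Matrix.add_mul, Matrix.mul_one, hUU, Matrix.mul_smul,
      Matrix.smul_mul, ← hspec]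
  rw [h1, Matrix.det_mul_comm, ← Matrix.mul_assoc, hUU', Matrix.one_mul, det_diagonal]

lemma one_le_det_one_add {d : ℕ} {A : Matrix (Fin d) (Fin d) ℝ} (hA : A.PosSemidef) :
    1 ≤ (1 + A).det := by
  have h := det_one_add_smul_eq_prod hA.1 1
  rw [one_smul] at h
  rw [h]
  refine Finset.one_le_prod fun i _ => ?_
  have := hA.eigenvalues_nonneg i
  linarith

open scoped MatrixOrder Matrix.Norms.L2Operator in
lemma exists_eq_conjTranspose_mul_self {d : ℕ} {A : Matrix (Fin d) (Fin d) ℝ}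
    (hA : A.PosSemidef) : ∃ Y : Matrix (Fin d) (Fin d) ℝ, A = Yᴴ * Y :=
  CStarAlgebra.nonneg_iff_eq_star_mul_self.mp hA.nonneg

lemma det_le_det_add {d : ℕ} {M N : Matrix (Fin d) (Fin d) ℝ} (hM : M.PosDef)
    (hN : N.PosSemidef) : M.det ≤ (M + N).det := by
  obtain ⟨Y, rfl⟩ := exists_eq_conjTranspose_mul_self hN
  rw [Matrix.det_add_mul _ _ hM.det_pos.ne'.isUnit]
  exact le_mul_of_one_le_right hM.det_pos.le
    (one_le_det_one_add (hM.inv.posSemidef.mul_mul_conjTranspose_same Y))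

lemma posSemidef_one_sub_inv_one_add {d : ℕ} {A : Matrix (Fin d) (Fin d) ℝ}
    (hA : A.PosSemidef) : (1 - (1 + A)⁻¹).PosSemidef := by
  have hM : (1 + A).PosDef := PosDef.one.add_posSemidef hA
  have hu : IsUnit (1 + A).det := hM.det_pos.ne'.isUnit
  have h1 : 1 - (1 + A)⁻¹ = (1 + A)⁻¹ * (A + A * Aᴴ) * ((1 + A)⁻¹)ᴴ := by
    have h2 : A + A * Aᴴ = A * (1 + A) := by rw [hA.1.eq, Matrix.mul_add, Matrix.mul_one]
    rw [hM.inv.1.eq, h2, Matrix.mul_assoc, Matrix.mul_assoc, Matrix.mul_nonsing_inv _ hu,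
      Matrix.mul_one]
    nth_rewrite 3 [show A = (1 + A) - 1 by abel]
    rw [Matrix.mul_sub, Matrix.nonsing_inv_mul _ hu, Matrix.mul_one]
  rw [h1]
  exact (hA.add (posSemidef_self_mul_conjTranspose A)).mul_mul_conjTranspose_same _

/-- Submultiplicativity of `A ↦ det (1 + A)` on the positive semidefinite cone. -/
lemma det_one_add_add_le {d : ℕ} {A B : Matrix (Fin d) (Fin d) ℝ} (hA : A.PosSemidef)
    (hB : B.PosSemidef) : (1 + (A + B)).det ≤ (1 + A).det * (1 + B).det := by
  obtain ⟨Y, rfl⟩ := exists_eq_conjTranspose_mul_self hB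
  have hM : (1 + A).PosDef := PosDef.one.add_posSemidef hA
  rw [← add_assoc, Matrix.det_add_mul _ _ hM.det_pos.ne'.isUnit, Matrix.det_one_add_mul_comm Yᴴ Y]
  refine mul_le_mul_of_nonneg_left ?_ hM.det_pos.le
  have h1 : 1 + Y * Yᴴ = (1 + Y * (1 + A)⁻¹ * Yᴴ) + Y * (1 - (1 + A)⁻¹) * Yᴴ := by
    rw [Matrix.mul_sub, Matrix.sub_mul, Matrix.mul_one]
    abel
  rw [h1]
  exact det_le_det_add
    (PosDef.one.add_posSemidef (hM.inv.posSemidef.mul_mul_conjTranspose_same Y))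
    ((posSemidef_one_sub_inv_one_add hA).mul_mul_conjTranspose_same Y)

lemma det_one_add_sum_le {d : ℕ} {ι : Type*} (s : Finset ι)
    {A : ι → Matrix (Fin d) (Fin d) ℝ} (hA : ∀ i, (A i).PosSemidef) :
    (1 + ∑ i ∈ s, A i).det ≤ ∏ i ∈ s, (1 + A i).det := by
  classical
  induction s using Finset.induction_on with
  | empty => simp
  | insert a s ha ih =>
    rw [Finset.sum_insert ha, Finset.prod_insert ha]
    exact (det_one_add_add_le (hA a) (posSemidef_sum s fun i _ => hA i)).trans
      (mul_le_mul_of_nonneg_left ih (zero_le_one.trans (one_le_det_one_add (hA a))))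

/-! ### The scalar problem -/

lemma hasDerivAt_rateGap {K μ x : ℝ} (hK : 0 < K) (hx : 0 ≤ x) :
    HasDerivAt (fun b => Real.log (1 + b) - 1 / K * Real.log (1 + K * b) - μ * b)
      (1 / (1 + x) - 1 / (1 + K * x) - μ) x := by
  have h1 : 0 < 1 + x := by positivity
  have h2 : 0 < 1 + K * x := by positivity
  have e1 : HasDerivAt (fun b : ℝ => Real.log (1 + b)) (1 / (1 + x)) x :=
    ((hasDerivAt_id x).const_add 1).log h1.ne'
  have e2 : HasDerivAt (fun b : ℝ => Real.log (1 + K * b)) (K * 1 / (1 + K * x)) x :=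
    (((hasDerivAt_id x).const_mul K).const_add 1).log h2.ne'
  refine ((e1.sub (e2.const_mul (1 / K))).sub ((hasDerivAt_id x).const_mul μ)).congr_deriv ?_
  field_simp

lemma rateGap_le {K c : ℝ} (hK : 1 ≤ K) (hc : 1 ≤ c)
    (hlog : Real.log K ≤ (K - 1) * (Real.log c - 1)) {b : ℝ} (hb : 0 ≤ b) :
    Real.log (1 + b) - 1 / K * Real.log (1 + K * b) - (1 / (1 + c) - 1 / (1 + K * c)) * b
      ≤ Real.log (1 + c) - 1 / K * Real.log (1 + K * c)
        - (1 / (1 + c) - 1 / (1 + K * c)) * c := by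
  have hK0 : 0 < K := by linarith
  have hc0 : 0 < c := by linarith
  set μ := 1 / (1 + c) - 1 / (1 + K * c) with hμ
  set g : ℝ → ℝ := fun b => Real.log (1 + b) - 1 / K * Real.log (1 + K * b) - μ * b with hg
  change g b ≤ g c
  have hder : ∀ x, 0 ≤ x → HasDerivAt g (1 / (1 + x) - 1 / (1 + K * x) - μ) x :=
    fun x hx => hasDerivAt_rateGap hK0 hx
  have hdereq : ∀ x, 0 ≤ x → 1 / (1 + x) - 1 / (1 + K * x) - μ
      = (K - 1) * ((x - c) * (1 - K * c * x))
        / ((1 + x) * (1 + K * x) * ((1 + c) * (1 + K * c))) := by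
    intro x hx
    have h1 : 1 + x ≠ 0 := by positivity
    have h2 : 1 + K * x ≠ 0 := by positivity
    have h3 : 1 + c ≠ 0 := by positivity
    have h4 : 1 + K * c ≠ 0 := by positivity
    rw [hμ]
    field_simp
    ring
  have hdpos : ∀ x, 0 ≤ x → 0 < (1 + x) * (1 + K * x) * ((1 + c) * (1 + K * c)) := by
    intro x hx
    positivity
  have hr0 : 0 < 1 / (K * c) := by positivity
  have hrc : 1 / (K * c) ≤ c := by
    rw [div_le_iff₀ (by positivity)]
    nlinarith [mul_le_mul hK hc zero_le_one hK0.le]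
  have hgc : 0 ≤ g c := by
    have h1 : μ * c ≤ (K - 1) / K := by
      have : μ * c = (K - 1) * c ^ 2 / ((1 + c) * (1 + K * c)) := by
        rw [hμ]
        field_simp
        ring
      rw [this, div_le_div_iff₀ (by positivity) hK0]
      have : 0 ≤ (K - 1) * (1 + c + K * c) := by
        have : 0 ≤ K - 1 := by linarith
        positivity
      nlinarith
    have h2 : Real.log (1 + K * c) ≤ Real.log K + Real.log (1 + c) := by
      rw [← Real.log_mul hK0.ne' (by positivity)]
      exact Real.log_le_log (by positivity) (by nlinarith)
    have h3 : Real.log c ≤ Real.log (1 + c) := Real.log_le_log hc0 (by linarith)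
    have h4 : 0 ≤ (K - 1) * (Real.log (1 + c) - 1) - Real.log K := by
      have : (K - 1) * Real.log c ≤ (K - 1) * Real.log (1 + c) :=
        mul_le_mul_of_nonneg_left h3 (by linarith)
      nlinarith
    have h5 : 1 / K * Real.log (1 + K * c) ≤ 1 / K * (Real.log K + Real.log (1 + c)) :=
      mul_le_mul_of_nonneg_left h2 (by positivity)
    have h6 : Real.log (1 + c) - 1 / K * (Real.log K + Real.log (1 + c)) - (K - 1) / K
        = ((K - 1) * (Real.log (1 + c) - 1) - Real.log K) / K := by
      field_simp
      ring
    have h7 := div_nonneg h4 hK0.le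
    change 0 ≤ Real.log (1 + c) - 1 / K * Real.log (1 + K * c) - μ * c
    linarith
  have hK1 : 0 ≤ K - 1 := by linarith
  rcases le_total b (1 / (K * c)) with h | h
  · have hanti : AntitoneOn g (Set.Icc 0 (1 / (K * c))) := by
      refine antitoneOn_of_deriv_nonpos (convex_Icc _ _)
        (fun x hx => (hder x hx.1).continuousAt.continuousWithinAt)
        (fun x hx => (hder x (interior_subset hx).1).differentiableAt.differentiableWithinAt) ?_
      intro x hx
      have hx' := interior_subset hx
      rw [(hder x hx'.1).deriv, hdereq x hx'.1]
      refine div_nonpos_of_nonpos_of_nonneg (mul_nonpos_of_nonneg_of_nonpos hK1 ?_) (hdpos x hx'.1).le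
      have h8 := hx'.2
      rw [le_div_iff₀ (by positivity)] at h8
      refine mul_nonpos_of_nonpos_of_nonneg ?_ ?_
      · linarith [hx'.2]
      · linarith
    have h9 := hanti ⟨le_rfl, hr0.le⟩ ⟨hb, h⟩ hb
    have h10 : g 0 = 0 := by simp [hg]
    linarith
  rcases le_total b c with h' | h'
  · have hmono : MonotoneOn g (Set.Icc (1 / (K * c)) c) := by
      have hnn : ∀ x ∈ Set.Icc (1 / (K * c)) c, 0 ≤ x := fun x hx => hr0.le.trans hx.1
      refine monotoneOn_of_deriv_nonneg (convex_Icc _ _)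
        (fun x hx => (hder x (hnn x hx)).continuousAt.continuousWithinAt)
        (fun x hx => (hder x (hnn x (interior_subset hx))).differentiableAt.differentiableWithinAt)
        ?_
      intro x hx
      have hx' := interior_subset hx
      rw [(hder x (hnn x hx')).deriv, hdereq x (hnn x hx')]
      refine div_nonneg (mul_nonneg hK1 ?_) (hdpos x (hnn x hx')).le
      have h8 := hx'.1
      rw [div_le_iff₀ (by positivity)] at h8
      refine mul_nonneg_of_nonpos_of_nonpos ?_ ?_
      · linarith [hx'.2]
      · linarith
    exact hmono ⟨h, h'⟩ ⟨hrc, le_rfl⟩ h'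
  · have hanti : AntitoneOn g (Set.Ici c) := by
      have hnn : ∀ x ∈ Set.Ici c, 0 ≤ x := fun x hx => hc0.le.trans hx
      refine antitoneOn_of_deriv_nonpos (convex_Ici _)
        (fun x hx => (hder x (hnn x hx)).continuousAt.continuousWithinAt)
        (fun x hx => (hder x (hnn x (interior_subset hx))).differentiableAt.differentiableWithinAt)
        ?_
      intro x hx
      have hx' := interior_subset hx
      rw [(hder x (hnn x hx')).deriv, hdereq x (hnn x hx')]
      refine div_nonpos_of_nonpos_of_nonneg (mul_nonpos_of_nonneg_of_nonpos hK1 ?_)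
        (hdpos x (hnn x hx')).le
      have h8 : c ≤ x := hx'
      have h9 : 1 / (K * c) ≤ x := hrc.trans h8
      rw [div_le_iff₀ (by positivity)] at h9
      refine mul_nonpos_of_nonneg_of_nonpos ?_ ?_
      · linarith
      · linarith
    exact hanti Set.self_mem_Ici h' h'

/-! ### Bounds on the coding precision -/

lemma le_exp_mul_rpow_of_le_epsBound {d K : ℕ} (mk : Fin K → ℕ) {ε : ℝ} (hK : 1 ≤ K)
    (hmd : d ≤ mTot mk) (hεle : ε ≤ epsBound d mk) :
    ε ≤ Real.exp (-(1 / 2)) * (K : ℝ) ^ (-(1 : ℝ) / ((K : ℝ) - 1)) := by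
  have hK' : (1 : ℝ) ≤ K := by exact_mod_cast hK
  have hsq : Real.sqrt ((d : ℝ) / (mTot mk : ℝ)) ≤ 1 := by
    refine Real.sqrt_le_one.mpr ?_
    exact div_le_one_of_le₀ (by exact_mod_cast hmd) (by positivity)
  have hpow : (1 + 1 / Real.sqrt (K : ℝ)) ^ (-(2 * (mTot mk : ℝ)) / ((K : ℝ) - 1)) ≤ 1 := by
    refine Real.rpow_le_one_of_one_le_of_nonpos ?_ ?_
    · have : 0 ≤ 1 / Real.sqrt (K : ℝ) := by positivity
      linarith
    · refine div_nonpos_of_nonpos_of_nonneg ?_ (by linarith)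
      have : (0 : ℝ) ≤ mTot mk := by positivity
      linarith
  have hE : 0 ≤ Real.exp (-(1 / 2)) * (K : ℝ) ^ (-(1 : ℝ) / ((K : ℝ) - 1)) := by positivity
  refine hεle.trans ?_
  unfold epsBound
  calc (1 / 6) * Real.sqrt ((d : ℝ) / (mTot mk : ℝ)) * Real.exp (-(1 / 2)) *
        (K : ℝ) ^ (-(1 : ℝ) / ((K : ℝ) - 1)) *
        (1 + 1 / Real.sqrt (K : ℝ)) ^ (-(2 * (mTot mk : ℝ)) / ((K : ℝ) - 1))
      ≤ (1 / 6) * Real.sqrt ((d : ℝ) / (mTot mk : ℝ)) * Real.exp (-(1 / 2)) *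
        (K : ℝ) ^ (-(1 : ℝ) / ((K : ℝ) - 1)) * 1 :=
        mul_le_mul_of_nonneg_left hpow (by positivity)
    _ = ((1 / 6) * Real.sqrt ((d : ℝ) / (mTot mk : ℝ))) *
        (Real.exp (-(1 / 2)) * (K : ℝ) ^ (-(1 : ℝ) / ((K : ℝ) - 1))) := by ring
    _ ≤ 1 * (Real.exp (-(1 / 2)) * (K : ℝ) ^ (-(1 : ℝ) / ((K : ℝ) - 1))) :=
        mul_le_mul_of_nonneg_right (by linarith) hE
    _ = _ := one_mul _

lemma log_le_of_le_epsBound {d K : ℕ} (mk : Fin K → ℕ) {ε : ℝ} (hK : 1 ≤ K)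
    (hmd : d ≤ mTot mk) (hε : 0 < ε) (hεle : ε ≤ epsBound d mk) :
    1 ≤ 1 / ε ^ 2 ∧ Real.log K ≤ ((K : ℝ) - 1) * (Real.log (1 / ε ^ 2) - 1) := by
  have hK' : (1 : ℝ) ≤ K := by exact_mod_cast hK
  have hKlog : 0 ≤ Real.log K := Real.log_nonneg hK'
  have h := Real.log_le_log hε (le_exp_mul_rpow_of_le_epsBound mk hK hmd hεle)
  rw [Real.log_mul (by positivity) (by positivity), Real.log_exp,
    Real.log_rpow (by linarith)] at h
  have hlog : Real.log (1 / ε ^ 2) = -(2 * Real.log ε) := by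
    rw [one_div, Real.log_inv, Real.log_pow]
    norm_num
  have hterm : -(1 : ℝ) / ((K : ℝ) - 1) * Real.log K ≤ 0 :=
    mul_nonpos_of_nonpos_of_nonneg
      (div_nonpos_of_nonpos_of_nonneg (by norm_num) (by linarith)) hKlog
  constructor
  · rw [← Real.log_nonneg_iff (by positivity), hlog]
    linarith
  · rw [hlog]
    rcases hK'.eq_or_lt with hK1 | hK1
    · rw [← hK1]
      simp
    · have hpos : 0 < (K : ℝ) - 1 := by linarith
      have h2 : ((K : ℝ) - 1) * Real.log ε
          ≤ ((K : ℝ) - 1) * (-(1 / 2) + -(1 : ℝ) / ((K : ℝ) - 1) * Real.log K) :=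
        mul_le_mul_of_nonneg_left h hpos.le
      have h3 : ((K : ℝ) - 1) * (-(1 / 2) + -(1 : ℝ) / ((K : ℝ) - 1) * Real.log K)
          = -(((K : ℝ) - 1) / 2) - Real.log K := by
        field_simp
        ring
      nlinarith

/-! ### Block structure -/

lemma frobSq_eq_sum_blk {d K : ℕ} (mk : Fin K → ℕ)
    (Z : Matrix (Fin d) ((k : Fin K) × Fin (mk k)) ℝ) :
    frobSq Z = ∑ k, frobSq (blk mk Z k) := by
  unfold frobSq blk
  rw [Finset.sum_comm]
  simp_rw [Fintype.sum_sigma]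
  rw [Finset.sum_comm]
  rw [Finset.sum_comm]
  exact Finset.sum_congr rfl fun k _ => Finset.sum_comm

lemma mul_transpose_eq_sum_blk {d K : ℕ} (mk : Fin K → ℕ)
    (Z : Matrix (Fin d) ((k : Fin K) × Fin (mk k)) ℝ) :
    Z * Zᵀ = ∑ k, blk mk Z k * (blk mk Z k)ᵀ := by
  ext i j
  simp [Matrix.mul_apply, Matrix.sum_apply, Fintype.sum_sigma, blk]

lemma frobSq_eq_trace {d : ℕ} {n : Type*} [Fintype n] (A : Matrix (Fin d) n ℝ) :
    frobSq A = (A * Aᵀ).trace := by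
  simp [frobSq, Matrix.trace, Matrix.mul_apply, pow_two]

lemma posSemidef_mul_transpose {d : ℕ} {n : Type*} [Fintype n] (A : Matrix (Fin d) n ℝ) :
    (A * Aᵀ).PosSemidef := by
  simpa using posSemidef_self_mul_conjTranspose A

/-- Upper bound for the regularized objective by its value on orthogonal blocks with the
same spectrum as `Z * Zᵀ`. -/
lemma mcr2_le_sum_eigenvalues {d K : ℕ} (mk : Fin K → ℕ) {a b lam : ℝ} (hb : 0 ≤ b)
    (ha : 0 ≤ a) {w : ℝ} (hw : 0 ≤ w)
    (Z : Matrix (Fin d) ((k : Fin K) × Fin (mk k)) ℝ) :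
    codingRate a Z - ∑ k, w * codingRate b (blk mk Z k) - (lam / 2) * frobSq Z
      ≤ 1 / 2 * ∑ i, (Real.log (1 + a * (posSemidef_mul_transpose Z).1.eigenvalues i)
        - w * Real.log (1 + b * (posSemidef_mul_transpose Z).1.eigenvalues i)
        - lam * (posSemidef_mul_transpose Z).1.eigenvalues i) := by
  set ev := (posSemidef_mul_transpose Z).1.eigenvalues with hev
  have hevn : ∀ i, 0 ≤ ev i := (posSemidef_mul_transpose Z).eigenvalues_nonneg
  have hlogdet : ∀ t : ℝ, 0 ≤ t →
      Real.log (1 + t • (Z * Zᵀ)).det = ∑ i, Real.log (1 + t * ev i) := by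
    intro t ht
    rw [det_one_add_smul_eq_prod (posSemidef_mul_transpose Z).1, Real.log_prod]
    intro i _
    have := mul_nonneg ht (hevn i)
    positivity
  have htr : frobSq Z = ∑ i, ev i := by
    rw [frobSq_eq_trace, (posSemidef_mul_transpose Z).1.trace_eq_sum_eigenvalues]
    rfl
  have hpsd : ∀ k, (b • (blk mk Z k * (blk mk Z k)ᵀ)).PosSemidef :=
    fun k => (posSemidef_mul_transpose _).smul hb
  have hsub : ∑ i, Real.log (1 + b * ev i)
      ≤ ∑ k, Real.log (1 + b • (blk mk Z k * (blk mk Z k)ᵀ)).det := by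
    rw [← hlogdet b hb, ← Real.log_prod
      (fun k _ => (zero_lt_one.trans_le (one_le_det_one_add (hpsd k))).ne')]
    refine Real.log_le_log
      (zero_lt_one.trans_le (one_le_det_one_add ((posSemidef_mul_transpose Z).smul hb))) ?_
    rw [mul_transpose_eq_sum_blk, Finset.smul_sum]
    exact det_one_add_sum_le _ hpsd
  have hsub' := mul_le_mul_of_nonneg_left hsub hw
  simp only [codingRate]
  rw [hlogdet a ha, htr, Finset.sum_sub_distrib, Finset.sum_sub_distrib, ← Finset.mul_sum,
    ← Finset.mul_sum, ← Finset.mul_sum, ← Finset.mul_sum]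
  linarith

/-! ### An orthogonal feasible point -/

lemma exists_balanced_embedding {d K n q : ℕ} (hd : d = K * q) (hq : q ≤ n) :
    ∃ σ : Fin d → (_ : Fin K) × Fin n, Function.Injective σ ∧
      ∀ (k : Fin K) (x : ℝ), ∑ i, (if (σ i).1 = k then x else 0) = q * x := by
  subst hd
  refine ⟨fun i => ⟨(finProdFinEquiv.symm i).1, Fin.castLE hq (finProdFinEquiv.symm i).2⟩, ?_, ?_⟩
  · intro i j hij
    simp only [Sigma.mk.injEq, heq_eq_eq] at hij
    exact finProdFinEquiv.symm.injective
      (Prod.ext hij.1 (Fin.castLE_injective hq hij.2))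
  · intro k x
    rw [Equiv.sum_comp finProdFinEquiv.symm (fun p : Fin K × Fin q => if p.1 = k then x else 0)]
    calc ∑ p : Fin K × Fin q, (if p.1 = k then x else 0)
        = ∑ a : Fin K, ∑ _b : Fin q, (if a = k then x else 0) := Fintype.sum_prod_type _
      _ = q * x := by simp

/-- Existence of a matrix with mutually orthogonal blocks, each with `d / K` nonzero singular
values, all equal to `√s`. -/
lemma exists_orthogonal_blocks {d K n q : ℕ} (hd : d = K * q) (hq : q ≤ n) {s : ℝ} (hs : 0 ≤ s) :
    ∃ Z : Matrix (Fin d) ((_ : Fin K) × Fin n) ℝ,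
      (∀ k, frobSq (blk (fun _ => n) Z k) = q * s) ∧
      (∀ a, 0 ≤ a → codingRate a Z = 1 / 2 * (d * Real.log (1 + a * s))) ∧
      ∀ a, 0 ≤ a → ∑ k, codingRate a (blk (fun _ => n) Z k)
        = 1 / 2 * (d * Real.log (1 + a * s)) := by
  obtain ⟨σ, hσ, hcount⟩ := exists_balanced_embedding hd hq
  have hss : √s * √s = s := Real.mul_self_sqrt hs
  set Z : Matrix (Fin d) ((_ : Fin K) × Fin n) ℝ :=
    Matrix.of fun i p => if σ i = p then √s else 0 with hZ
  have hblk : ∀ k, blk (fun _ => n) Z k * (blk (fun _ => n) Z k)ᵀ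
      = diagonal fun i => if (σ i).1 = k then s else 0 := by
    intro k
    ext i j
    rw [Matrix.mul_apply, diagonal_apply]
    have hterm : ∀ l : Fin n, blk (fun _ => n) Z k i l * (blk (fun _ => n) Z k)ᵀ l j
        = if σ i = ⟨k, l⟩ ∧ i = j then s else 0 := by
      intro l
      simp only [blk, hZ, Matrix.of_apply, Matrix.transpose_apply]
      by_cases h1 : σ i = ⟨k, l⟩
      · by_cases h2 : i = j
        · subst h2
          simp [h1, hss]
        · have : σ j ≠ ⟨k, l⟩ := fun h3 => h2 (hσ (h1.trans h3.symm))
          simp [h2, this]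
      · simp [h1]
    rw [Finset.sum_congr rfl fun l _ => hterm l]
    by_cases h2 : i = j
    · simp only [h2, and_true, if_true]
      by_cases h3 : (σ j).1 = k
      · rw [if_pos h3, Finset.sum_eq_single (σ j).2]
        · rw [if_pos (show σ j = ⟨k, (σ j).2⟩ from Sigma.ext h3 HEq.rfl)]
        · intro l _ hl
          rw [if_neg]
          intro h4
          exact hl (by rw [h4])
        · simp
      · rw [if_neg h3]
        refine Finset.sum_eq_zero fun l _ => if_neg fun h4 => h3 (by rw [h4])
    · simp [h2]
  have hfull : Z * Zᵀ = diagonal fun _ => s := by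
    rw [mul_transpose_eq_sum_blk (fun _ => n) Z, Finset.sum_congr rfl fun k _ => hblk k]
    ext i j
    rw [Matrix.sum_apply]
    by_cases h : i = j <;> simp [h]
  have hdet : ∀ (a : ℝ) (v : Fin d → ℝ),
      (1 + a • diagonal v).det = ∏ i, (1 + a * v i) := by
    intro a v
    rw [← diagonal_one, ← diagonal_smul, diagonal_add, det_diagonal]
    rfl
  refine ⟨Z, fun k => ?_, fun a ha => ?_, fun a ha => ?_⟩
  · rw [frobSq_eq_trace, hblk, trace_diagonal, hcount]
  · rw [codingRate, hfull, hdet]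
    simp
  · have hpos : ∀ (k : Fin K) (i : Fin d), 1 + a * (if (σ i).1 = k then s else 0) ≠ 0 := by
      intro k i
      split_ifs <;> positivity
    have hlog : ∀ k : Fin K, codingRate a (blk (fun _ => n) Z k)
        = 1 / 2 * (q * Real.log (1 + a * s)) := by
      intro k
      rw [codingRate, hblk, hdet, Real.log_prod fun i _ => hpos k i, ← hcount k]
      congr 1
      refine Finset.sum_congr rfl fun i _ => ?_
      split_ifs <;> simp
    rw [Finset.sum_congr rfl fun k _ => hlog k]
    simp [hd]
    ring

/-- **Proposition 2.1(ii):** for balanced classes, `m ≥ d` with `K ∣ d`, small `ε`, and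
`λ = α/(1+αm/d) − α/(1+αKm/d)`, every global solution of the constrained MCR² problem
is a global solution of the regularized MCR² problem. -/
theorem mcr2_constrained_subset_regularized_global (d K : ℕ) (mk : Fin K → ℕ) (ε lam : ℝ)
    (hmk : ∀ k, 0 < mk k) (hbal : ∀ k l, mk k = mk l)
    (hmd : d ≤ mTot mk) (hdK : K ∣ d)
    (hε : 0 < ε) (hεle : ε ≤ epsBound d mk)
    (hlam : lam = alph d mk ε / (1 + alph d mk ε * (mTot mk : ℝ) / (d : ℝ))
        - alph d mk ε / (1 + alph d mk ε * (K : ℝ) * (mTot mk : ℝ) / (d : ℝ))) :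
    ∀ Z : Matrix (Fin d) ((k : Fin K) × Fin (mk k)) ℝ,
      IsConstrainedGlobalMax d K mk ε Z →
        (∀ W : Matrix (Fin d) ((k : Fin K) × Fin (mk k)) ℝ,
          mcr2F d K mk ε lam W ≤ mcr2F d K mk ε lam Z) := by
  intro Z hZ W
  rcases Nat.eq_zero_or_pos d with hd0 | hd
  · subst hd0
    exact (congrArg (mcr2F 0 K mk ε lam) (Subsingleton.elim W Z)).le
  have hK : 1 ≤ K := Nat.pos_of_ne_zero fun h => hd.ne' (by subst h; exact Nat.zero_dvd.mp hdK)
  obtain ⟨n, rfl⟩ : ∃ n, mk = fun _ => n := ⟨mk ⟨0, hK⟩, funext fun k => hbal k _⟩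
  obtain ⟨q, hq⟩ := hdK
  have hn : 0 < n := hmk ⟨0, hK⟩
  have hm : mTot (fun _ : Fin K => n) = K * n := by simp [mTot]
  have hqn : q ≤ n := by
    rw [hm, hq] at hmd
    exact Nat.le_of_mul_le_mul_left hmd hK
  obtain ⟨hc, hlogc⟩ := log_le_of_le_epsBound (fun _ : Fin K => n) hK hmd hε hεle
  set c : ℝ := 1 / ε ^ 2 with hcdef
  have hdR : (0 : ℝ) < d := by exact_mod_cast hd
  have hKR : (1 : ℝ) ≤ K := by exact_mod_cast hK
  have hK0 : (0 : ℝ) < K := by linarith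
  have hnR : (0 : ℝ) < n := by exact_mod_cast hn
  have hqR : (d : ℝ) = K * q := by exact_mod_cast hq
  set α := alph d (fun _ : Fin K => n) ε with hα
  have hαeq : α = d / (K * n * ε ^ 2) := by rw [hα, alph, hm]; push_cast; rfl
  have hα0 : 0 < α := by rw [hαeq]; positivity
  have hαk : ∀ k, alphK d (fun _ : Fin K => n) ε k = K * α := by
    intro k
    rw [hαeq, alphK]
    field_simp
  have hw : ∀ k : Fin K, (((fun _ : Fin K => n) k : ℕ) : ℝ) / (mTot (fun _ : Fin K => n) : ℝ)
      = 1 / K := by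
    intro k
    rw [hm]
    push_cast
    field_simp
  set s : ℝ := K * n / d with hs
  have hs0 : 0 < s := by positivity
  have hαs : α * s = c := by
    rw [hαeq, hs, hcdef]
    field_simp
  have hlamμ : lam = α * (1 / (1 + c) - 1 / (1 + K * c)) := by
    rw [hlam, hm, ← hαs, hs]
    push_cast
    ring_nf
  have hF : ∀ (l : ℝ) (V : Matrix (Fin d) ((_ : Fin K) × Fin n) ℝ),
      mcr2F d K (fun _ => n) ε l V = codingRate α V
        - ∑ k, 1 / (K : ℝ) * codingRate (K * α) (blk (fun _ => n) V k) - l / 2 * frobSq V := by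
    intro l V
    unfold mcr2F
    rw [Finset.sum_congr rfl fun k _ => by rw [hw k, hαk k]]
  obtain ⟨Y, hYfrob, hYrate, hYblk⟩ := exists_orthogonal_blocks hq hqn hs0.le
  have hqs : (q : ℝ) * s = n := by
    rw [hs, hqR]
    have : (q : ℝ) ≠ 0 := by
      rintro h
      rw [h, mul_zero] at hqR
      exact hdR.ne' hqR
    field_simp
  have hYfeas : ∀ k, frobSq (blk (fun _ => n) Y k) = (n : ℝ) := fun k => (hYfrob k).trans hqs
  have hYZ : mcr2F d K (fun _ => n) ε lam Y ≤ mcr2F d K (fun _ => n) ε lam Z := by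
    have h := hZ.2 Y hYfeas
    have hfr : frobSq Y = frobSq Z := by
      rw [frobSq_eq_sum_blk (fun _ => n) Y, frobSq_eq_sum_blk (fun _ => n) Z]
      exact Finset.sum_congr rfl fun k _ => (hYfeas k).trans (hZ.1 k).symm
    rw [hF, hF] at h ⊢
    rw [hfr] at h ⊢
    linarith
  refine le_trans ?_ hYZ
  have hYval : mcr2F d K (fun _ => n) ε lam Y
      = 1 / 2 * ∑ _i : Fin d, (Real.log (1 + c) - 1 / K * Real.log (1 + K * c)
        - (1 / (1 + c) - 1 / (1 + K * c)) * c) := by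
    rw [hF, ← Finset.mul_sum, hYrate α hα0.le, hYblk (K * α) (by positivity),
      frobSq_eq_sum_blk (fun _ => n) Y, Finset.sum_congr rfl fun k _ => hYfrob k, hlamμ,
      mul_assoc (K : ℝ) α s, hαs]
    simp only [Finset.sum_const, Finset.card_univ, Fintype.card_fin, nsmul_eq_mul]
    rw [← hαs, hqR]
    ring
  rw [hYval, hF]
  refine (mcr2_le_sum_eigenvalues (fun _ => n) (by positivity) hα0.le (by positivity) W).trans ?_
  refine mul_le_mul_of_nonneg_left (Finset.sum_le_sum fun i _ => ?_) (by norm_num)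
  have hb := mul_nonneg hα0.le ((posSemidef_mul_transpose W).eigenvalues_nonneg i)
  have hgap := rateGap_le hKR hc hlogc hb
  rw [hlamμ, mul_assoc (K : ℝ) α]
  linarith

end
end

section
/- Let Z = [Z_1, …, Z_K] ∈ ℝ^{d×m} with Z_k ∈ ℝ^{d×m_k} for each k ∈ [K], and let α > 0. Then log det(I_d + α Z Zᵀ) ≤ Σ_{k=1}^K log det(I_d + α Z_k Z_kᵀ), and equality holds if and only if Z_kᵀZ_l = 0 for all k ≠ l ∈ [K]. -/
open Matrix BigOperators Finset

noncomputable section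

/-- The determinant of a block diagonal matrix is the product of the determinants of its blocks. -/
theorem Matrix.det_blockDiagonal' {ι R : Type*} [Fintype ι] [LinearOrder ι] [CommRing R]
    {m : ι → Type*} [∀ i, Fintype (m i)] [∀ i, DecidableEq (m i)]
    (M : ∀ i, Matrix (m i) (m i) R) : (blockDiagonal' M).det = ∏ i, (M i).det := by
  rw [(blockTriangular_blockDiagonal' M).det_fintype]
  refine Finset.prod_congr rfl fun i _ => ?_
  rw [← det_submatrix_equiv_self (Equiv.sigmaSubtype i).symm]
  congr 1
  ext j k
  exact blockDiagonal'_apply_eq M i j k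

/-- A block diagonal matrix with positive definite blocks is positive definite. -/
theorem Matrix.PosDef.blockDiagonal' {ι : Type*} [Fintype ι] [LinearOrder ι]
    {m : ι → Type*} [∀ i, Fintype (m i)] [∀ i, DecidableEq (m i)]
    {M : ∀ i, Matrix (m i) (m i) ℝ} (hM : ∀ i, (M i).PosDef) :
    (blockDiagonal' M).PosDef := by
  have hfactor (i) : ∃ B : Matrix (m i) (m i) ℝ, M i = Bᴴ * B := by
    open scoped MatrixOrder in
    exact CStarAlgebra.nonneg_iff_eq_star_mul_self.mp (hM i).posSemidef.nonneg
  choose B hB using hfactor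
  have hpsd : (Matrix.blockDiagonal' M).PosSemidef := by
    have h : M = fun i => (B i)ᴴ * B i := funext hB
    rw [h, blockDiagonal'_mul, ← blockDiagonal'_conjTranspose]
    exact posSemidef_conjTranspose_mul_self _
  rw [hpsd.posDef_iff_det_ne_zero, det_blockDiagonal']
  exact Finset.prod_ne_zero_iff.mpr fun i _ => (hM i).det_pos.ne'

/-- A positive definite matrix satisfies `log det W ≤ tr W - n`, with equality only at the
identity. -/
theorem Matrix.PosDef.log_det_le_trace_sub_card {n : Type*} [Fintype n] [DecidableEq n]
    {W : Matrix n n ℝ} (hW : W.PosDef) :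
    Real.log W.det ≤ W.trace - Fintype.card n ∧
      (Real.log W.det = W.trace - Fintype.card n ↔ W = 1) := by
  have hpos := hW.eigenvalues_pos
  have hlog : Real.log W.det = ∑ i, Real.log (hW.1.eigenvalues i) := by
    rw [hW.1.det_eq_prod_eigenvalues]
    exact Real.log_prod fun i _ => (hpos i).ne'
  have htr : W.trace - Fintype.card n = ∑ i, (hW.1.eigenvalues i - 1) := by
    rw [hW.1.trace_eq_sum_eigenvalues]
    simp
  have hle (i) := Real.log_le_sub_one_of_pos (hpos i)
  refine ⟨hlog ▸ htr ▸ Finset.sum_le_sum fun i _ => hle i, fun h => ?_, ?_⟩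
  · rw [hlog, htr, Finset.sum_eq_sum_iff_of_le fun i _ => hle i] at h
    have hone : hW.1.eigenvalues = 1 := by
      funext i
      by_contra hne
      exact (Real.log_lt_sub_one_of_pos (hpos i) hne).ne (h i (Finset.mem_univ i))
    rw [hW.1.spectral_theorem, hone]
    have hdiag : diagonal (RCLike.ofReal ∘ (1 : n → ℝ)) = (1 : Matrix n n ℝ) := by
      ext i j
      simp [diagonal_apply, one_apply]
    rw [hdiag, map_one]
  · rintro rfl
    simp

/-- If `tr (D⁻¹ G) = n` for positive definite `D` and `G`, then `log det G ≤ log det D`, with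
equality only for `G = D`. -/
theorem Matrix.PosDef.log_det_le_log_det_of_trace_inv_mul {n : Type*} [Fintype n] [DecidableEq n]
    {G D : Matrix n n ℝ} (hG : G.PosDef) (hD : D.PosDef)
    (htr : (D⁻¹ * G).trace = Fintype.card n) :
    Real.log G.det ≤ Real.log D.det ∧ (Real.log G.det = Real.log D.det ↔ G = D) := by
  obtain ⟨B, hB⟩ : ∃ B : Matrix n n ℝ, D⁻¹ = B * Bᴴ := by
    open scoped MatrixOrder in
    exact CStarAlgebra.nonneg_iff_eq_mul_star_self.mp hD.inv.posSemidef.nonneg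
  have hDB : D * B * Bᴴ = 1 := by
    rw [Matrix.mul_assoc, ← hB, mul_nonsing_inv _ hD.det_pos.ne'.isUnit]
  have hBDB : Bᴴ * D * B = 1 := by
    rw [Matrix.mul_assoc]
    exact mul_eq_one_comm.mp hDB
  have hBu : IsUnit B := .of_mul_eq_one_right _ hBDB
  have hW : (Bᴴ * G * B).PosDef := (hBu.posDef_star_left_conjugate_iff).mpr hG
  have hWtr : (Bᴴ * G * B).trace = Fintype.card n := by
    rw [← htr, hB, Matrix.mul_assoc, trace_mul_comm, Matrix.mul_assoc, trace_mul_comm,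
      Matrix.mul_assoc]
  have hdet : (Bᴴ * G * B).det * D.det = G.det := by
    have h := congrArg det hBDB
    simp only [det_mul, det_one] at h ⊢
    linear_combination G.det * h
  have hlog : Real.log G.det = Real.log (Bᴴ * G * B).det + Real.log D.det := by
    rw [← hdet, Real.log_mul hW.det_pos.ne' hD.det_pos.ne']
  have hone : Bᴴ * G * B = 1 ↔ G = D := by
    rw [← hBDB, hBu.mul_left_inj, ← star_eq_conjTranspose, hBu.star.mul_right_inj]
  have hmain := hW.log_det_le_trace_sub_card
  rw [hWtr, sub_self, hone] at hmain
  rw [hlog]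
  exact ⟨by linarith [hmain.1], by rw [← hmain.2]; constructor <;> intro h <;> linarith⟩

/-- The **Fischer inequality** with its equality case, in logarithmic form. -/
theorem Matrix.PosDef.log_det_le_sum_log_det_blockDiag' {ι : Type*} [Fintype ι] [LinearOrder ι]
    {m : ι → Type*} [∀ i, Fintype (m i)] [∀ i, DecidableEq (m i)]
    {G : Matrix ((i : ι) × m i) ((i : ι) × m i) ℝ} (hG : G.PosDef) :
    Real.log G.det ≤ ∑ i, Real.log (blockDiag' G i).det ∧
      (Real.log G.det = ∑ i, Real.log (blockDiag' G i).det ↔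
        G = Matrix.blockDiagonal' (blockDiag' G)) := by
  have hblock (i) : (blockDiag' G i).PosDef :=
    hG.submatrix (e := fun j : m i => (⟨i, j⟩ : (i : ι) × m i)) sigma_mk_injective
  have hinv : (Matrix.blockDiagonal' (blockDiag' G))⁻¹ =
      Matrix.blockDiagonal' fun i => (blockDiag' G i)⁻¹ := by
    refine inv_eq_left_inv ?_
    rw [← blockDiagonal'_mul, ← blockDiagonal'_one]
    congr 1
    funext i
    exact nonsing_inv_mul _ (hblock i).det_pos.ne'.isUnit
  have htrace (N : ∀ i, Matrix (m i) (m i) ℝ) :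
      (Matrix.blockDiagonal' N * G).trace = ∑ i, (N i * blockDiag' G i).trace := by
    simp only [trace, diag_apply, mul_apply, Fintype.sum_sigma, blockDiag'_apply]
    refine Finset.sum_congr rfl fun i _ => Finset.sum_congr rfl fun j _ => ?_
    rw [Finset.sum_eq_single i]
    · simp
    · intro k _ hk
      simp [blockDiagonal'_apply_ne _ _ _ hk.symm]
    · simp
  have hsum : ∑ i, Real.log (blockDiag' G i).det =
      Real.log (Matrix.blockDiagonal' (blockDiag' G)).det := by
    rw [det_blockDiagonal', Real.log_prod fun i _ => (hblock i).det_pos.ne']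
  rw [hsum]
  refine hG.log_det_le_log_det_of_trace_inv_mul (.blockDiagonal' hblock) ?_
  rw [hinv, htrace]
  simp [nonsing_inv_mul _ (hblock _).det_pos.ne'.isUnit]

/-- **Lemma A.2:** `log det (I + α Z Zᵀ) ≤ ∑ k log det (I + α Z_k Z_kᵀ)`, with equality
iff the blocks are pairwise orthogonal. -/
theorem logdet_subadditive_blocks (d K : ℕ) (mk : Fin K → ℕ) (a : ℝ) (ha : 0 < a)
    (Z : Matrix (Fin d) ((k : Fin K) × Fin (mk k)) ℝ) :
    Real.log ((1 + a • (Z * Zᵀ)).det) ≤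
      ∑ k, Real.log ((1 + a • (blk mk Z k * (blk mk Z k)ᵀ)).det) ∧
    (Real.log ((1 + a • (Z * Zᵀ)).det) =
        ∑ k, Real.log ((1 + a • (blk mk Z k * (blk mk Z k)ᵀ)).det) ↔
      ∀ k l, k ≠ l → (blk mk Z k)ᵀ * blk mk Z l = 0) := by
  have hG : (1 + a • (Zᵀ * Z)).PosDef :=
    PosDef.one.add_posSemidef ((posSemidef_conjTranspose_mul_self Z).smul ha.le)
  have hdet {n : Type} [Fintype n] [DecidableEq n] (A : Matrix (Fin d) n ℝ) :
      (1 + a • (A * Aᵀ)).det = (1 + a • (Aᵀ * A)).det := by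
    rw [← Matrix.smul_mul, det_one_add_mul_comm, Matrix.mul_smul]
  have hdiag (k) : blockDiag' (1 + a • (Zᵀ * Z)) k = 1 + a • ((blk mk Z k)ᵀ * blk mk Z k) := by
    ext i j
    simp [blockDiag'_apply, one_apply, mul_apply, blk]
  have hoff : 1 + a • (Zᵀ * Z) = Matrix.blockDiagonal' (blockDiag' (1 + a • (Zᵀ * Z))) ↔
      ∀ k l, k ≠ l → (blk mk Z k)ᵀ * blk mk Z l = 0 := by
    constructor
    · intro h k l hkl
      ext i j
      have hij := congrFun₂ h ⟨k, i⟩ ⟨l, j⟩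
      rw [blockDiagonal'_apply_ne _ _ _ hkl] at hij
      simpa [one_apply, hkl, ha.ne', mul_apply, blk] using hij
    · intro h
      ext ⟨k, i⟩ ⟨l, j⟩
      obtain rfl | hkl := eq_or_ne k l
      · rw [blockDiagonal'_apply_eq, blockDiag'_apply]
      · have hij := congrFun₂ (h k l hkl) i j
        rw [blockDiagonal'_apply_ne _ _ _ hkl]
        simpa [one_apply, hkl, ha.ne', mul_apply, blk] using hij
  have hmain := hG.log_det_le_sum_log_det_blockDiag'
  simp only [hdet]
  simpa only [hoff, hdiag] using hmain

end
end

section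
/- Let m and K ≥ 2 be integers such that m/K is a positive integer, let r ≤ m/K be a positive integer, and let α > 0 be a constant satisfying α ≥ 6 K^{1/(K−1)} exp(1) (1 + 1/√K)^{m/(K−1)}. Then the optimization problem: minimize over x ∈ ℝ^r the function Σ_{i=1}^r [−log(1 + αx_i) + (1/K) log(1 + Kαx_i)] subject to Σ_{i=1}^r x_i = m/K and x_i ≥ 0 for all i ∈ [r], has the unique optimal solution x_i* = m/(rK) for all i ∈ [r]. -/
open BigOperators Finset

noncomputable section

/-- The objective `g(x) = ∑ i [−log(1 + αx_i) + (1/K) log(1 + Kαx_i)]`. -/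
def kktObj (K r : ℕ) (α : ℝ) (x : Fin r → ℝ) : ℝ :=
  ∑ i, (-Real.log (1 + α * x i) + (1 / (K : ℝ)) * Real.log (1 + (K : ℝ) * α * x i))

/-- The feasible set: `∑ i x_i = m/K` and `x_i ≥ 0` for all `i`. -/
def kktFeasible (m K r : ℕ) (x : Fin r → ℝ) : Prop :=
  (∑ i, x i = (m : ℝ) / (K : ℝ)) ∧ ∀ i, 0 ≤ x i

/-- The derivative of `u ↦ -log (1 + u) + κ⁻¹ log (1 + κ u)`, tilted by its slope at `c`. -/
lemma hasDerivAt_tilted_log {κ c u : ℝ} (hκ : 1 < κ) (hc : 0 < c) (hu : 0 ≤ u) :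
    HasDerivAt (fun u : ℝ => -Real.log (1 + u) + 1 / κ * Real.log (1 + κ * u)
        + (κ - 1) * c / ((1 + c) * (1 + κ * c)) * u)
      ((κ - 1) * ((u - c) * (κ * u * c - 1)) /
        ((1 + u) * (1 + κ * u) * ((1 + c) * (1 + κ * c)))) u := by
  have hκ0 : 0 < κ := by linarith
  have h1 : 0 < 1 + u := by linarith
  have h2 : 0 < 1 + κ * u := by positivity
  have h3 : 0 < 1 + c := by linarith
  have h4 : 0 < 1 + κ * c := by positivity
  have d1 : HasDerivAt (fun u : ℝ => 1 + u) 1 u := (hasDerivAt_id u).const_add 1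
  have d2 : HasDerivAt (fun u : ℝ => 1 + κ * u) (κ * 1) u :=
    ((hasDerivAt_id u).const_mul κ).const_add 1
  have d3 : HasDerivAt (fun u : ℝ => (κ - 1) * c / ((1 + c) * (1 + κ * c)) * u)
      ((κ - 1) * c / ((1 + c) * (1 + κ * c)) * 1) u := (hasDerivAt_id u).const_mul _
  refine (((d1.log h1.ne').neg.add ((d2.log h2.ne').const_mul (1 / κ))).add d3).congr_deriv ?_
  field_simp
  ring

/-- On `[0, ∞)` the graph of `u ↦ -log (1 + u) + κ⁻¹ log (1 + κ u)` lies strictly above its tangent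
line at `c`, except at `c`, provided `c` is large. -/
lemma tilted_log_lt {κ c u : ℝ} (hκ : 1 < κ) (hc : 0 < c)
    (hlog : (κ - 1) + Real.log κ ≤ (κ - 1) * Real.log c) (hu : 0 ≤ u) (huc : u ≠ c) :
    -Real.log (1 + c) + 1 / κ * Real.log (1 + κ * c)
        + (κ - 1) * c / ((1 + c) * (1 + κ * c)) * c <
      -Real.log (1 + u) + 1 / κ * Real.log (1 + κ * u)
        + (κ - 1) * c / ((1 + c) * (1 + κ * c)) * u := by
  set φ : ℝ → ℝ := fun u => -Real.log (1 + u) + 1 / κ * Real.log (1 + κ * u)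
    + (κ - 1) * c / ((1 + c) * (1 + κ * c)) * u with hφ
  change φ c < φ u
  have hκ0 : 0 < κ := by linarith
  have hκ1 : 0 < κ - 1 := by linarith
  have hlogκ : 0 < Real.log κ := Real.log_pos hκ
  have hc1 : 1 < c := by
    refine (Real.log_pos_iff hc.le).1 ?_
    by_contra! h
    nlinarith
  have hκc : 1 < κ * c := by nlinarith
  have hκc0 : 0 < κ * c := by linarith
  have hderiv : ∀ x, 0 ≤ x → HasDerivAt φ ((κ - 1) * ((x - c) * (κ * x * c - 1)) /
      ((1 + x) * (1 + κ * x) * ((1 + c) * (1 + κ * c)))) x :=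
    fun x hx => hasDerivAt_tilted_log hκ hc hx
  have hcont : ContinuousOn φ (Set.Ici 0) :=
    fun x hx => (hderiv x hx).continuousAt.continuousWithinAt
  have hzero : φ c < φ 0 := by
    have hfrac : κ * ((κ - 1) * c / ((1 + c) * (1 + κ * c)) * c) < κ - 1 := by
      have e : κ * ((κ - 1) * c / ((1 + c) * (1 + κ * c)) * c)
          = (κ - 1) * (κ * c * c) / ((1 + c) * (1 + κ * c)) := by ring
      rw [e, div_lt_iff₀ (by positivity)]
      exact mul_lt_mul_of_pos_left (by nlinarith) hκ1
    have hle : Real.log (1 + κ * c) ≤ Real.log κ + Real.log (1 + c) := by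
      rw [← Real.log_mul hκ0.ne' (by positivity)]
      exact Real.log_le_log (by positivity) (by linarith)
    have hle' : (κ - 1) * Real.log c ≤ (κ - 1) * Real.log (1 + c) :=
      mul_le_mul_of_nonneg_left (Real.log_le_log hc (by linarith)) hκ1.le
    have hmul : κ * φ c = -(κ * Real.log (1 + c)) + Real.log (1 + κ * c)
        + κ * ((κ - 1) * c / ((1 + c) * (1 + κ * c)) * c) := by
      simp only [hφ]
      rw [mul_add, mul_add, ← mul_assoc κ (1 / κ), mul_one_div_cancel hκ0.ne']
      ring
    have h0 : φ 0 = 0 := by simp [hφ]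
    rw [h0]
    by_contra! h
    have := mul_nonneg hκ0.le h
    linarith
  have hb0 : 0 < 1 / (κ * c) := by positivity
  have hbc : 1 / (κ * c) < c := by
    rw [div_lt_iff₀ hκc0]
    nlinarith
  rcases lt_or_gt_of_ne huc with hlt | hgt
  · rcases le_or_gt u (1 / (κ * c)) with hub | hub
    · have hmono : MonotoneOn φ (Set.Icc 0 (1 / (κ * c))) := by
        refine monotoneOn_of_deriv_nonneg (convex_Icc _ _)
          (hcont.mono Set.Icc_subset_Ici_self)
          (fun x hx => ?_) fun x hx => ?_
        · rw [interior_Icc] at hx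
          exact (hderiv x hx.1.le).differentiableAt.differentiableWithinAt
        · rw [interior_Icc] at hx
          have hx0 : 0 < x := hx.1
          have hx1 : x * (κ * c) < 1 := (lt_div_iff₀ hκc0).1 hx.2
          rw [(hderiv x hx0.le).deriv]
          refine div_nonneg (mul_nonneg hκ1.le (mul_nonneg_of_nonpos_of_nonpos ?_ ?_))
            (by positivity)
          · linarith [hx.2]
          · linarith
      exact hzero.trans_le (hmono ⟨le_rfl, hb0.le⟩ ⟨hu, hub⟩ hu)
    · have hanti : StrictAntiOn φ (Set.Icc (1 / (κ * c)) c) := by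
        refine strictAntiOn_of_deriv_neg (convex_Icc _ _)
          (hcont.mono fun x hx => hb0.le.trans hx.1) fun x hx => ?_
        rw [interior_Icc] at hx
        have hx0 : 0 < x := hb0.trans hx.1
        have hx1 : 1 < x * (κ * c) := (div_lt_iff₀ hκc0).1 hx.1
        rw [(hderiv x hx0.le).deriv]
        refine div_neg_of_neg_of_pos (mul_neg_of_pos_of_neg hκ1 (mul_neg_of_neg_of_pos ?_ ?_))
          (by positivity)
        · linarith [hx.2]
        · linarith
      exact hanti ⟨hub.le, hlt.le⟩ ⟨hbc.le, le_rfl⟩ hlt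
  · have hmono : StrictMonoOn φ (Set.Ici c) := by
      refine strictMonoOn_of_deriv_pos (convex_Ici _)
        (hcont.mono (Set.Ici_subset_Ici.2 hc.le)) fun x hx => ?_
      rw [interior_Ici] at hx
      have hxc : c < x := hx
      have hx0 : 0 < x := hc.trans hxc
      have hx1 : 1 < κ * x * c := by nlinarith [mul_pos hκ0 hx0]
      rw [(hderiv x hx0.le).deriv]
      exact div_pos (mul_pos hκ1 (mul_pos (by linarith) (by linarith))) (by positivity)
    exact hmono Set.self_mem_Ici hgt.le hgt

/-- A point of the feasible set other than the uniform one has a strictly larger objective. -/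
lemma kktObj_const_lt {m K r : ℕ} {α : ℝ} (hK : 2 ≤ K) (hm : 0 < m) (hr : 0 < r) (hα : 0 < α)
    (hlog : ((K : ℝ) - 1) + Real.log K ≤
      ((K : ℝ) - 1) * Real.log (α * ((m : ℝ) / ((r : ℝ) * (K : ℝ)))))
    {x : Fin r → ℝ} (hx : kktFeasible m K r x)
    (hne : x ≠ fun _ => (m : ℝ) / ((r : ℝ) * (K : ℝ))) :
    kktObj K r α (fun _ => (m : ℝ) / ((r : ℝ) * (K : ℝ))) < kktObj K r α x := by
  obtain ⟨hsum, hnonneg⟩ := hx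
  have hK1 : (1 : ℝ) < K := by exact_mod_cast hK
  have hK0 : (0 : ℝ) < K := by linarith
  have hm0 : (0 : ℝ) < m := by exact_mod_cast hm
  have hr0 : (0 : ℝ) < r := by exact_mod_cast hr
  set a : ℝ := (m : ℝ) / ((r : ℝ) * (K : ℝ)) with ha
  have ha0 : 0 < a := by positivity
  have hc : 0 < α * a := by positivity
  set s : ℝ := ((K : ℝ) - 1) * (α * a) / ((1 + α * a) * (1 + K * (α * a)))
  obtain ⟨j, hj⟩ := Function.ne_iff.1 hne
  have hlt : ∀ i, x i ≠ a → -Real.log (1 + α * a) + 1 / (K : ℝ) * Real.log (1 + K * α * a)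
      + s * (α * a) < -Real.log (1 + α * x i) + 1 / (K : ℝ) * Real.log (1 + K * α * x i)
      + s * (α * x i) := by
    intro i hi
    rw [mul_assoc (K : ℝ), mul_assoc (K : ℝ)]
    exact tilted_log_lt hK1 hc hlog (mul_nonneg hα.le (hnonneg i))
      fun h => hi (mul_left_cancel₀ hα.ne' h)
  have hall : ∑ _i : Fin r, (-Real.log (1 + α * a) + 1 / (K : ℝ) * Real.log (1 + K * α * a)
      + s * (α * a)) < ∑ i, (-Real.log (1 + α * x i)
      + 1 / (K : ℝ) * Real.log (1 + K * α * x i) + s * (α * x i)) := by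
    refine Finset.sum_lt_sum (fun i _ => ?_) ⟨j, Finset.mem_univ j, hlt j hj⟩
    by_cases hi : x i = a
    · rw [hi]
    · exact (hlt i hi).le
  have hsplit : ∀ y : Fin r → ℝ, ∑ i, (-Real.log (1 + α * y i)
      + 1 / (K : ℝ) * Real.log (1 + K * α * y i) + s * (α * y i))
      = kktObj K r α y + s * (α * ∑ i, y i) := fun y => by
    rw [Finset.sum_add_distrib, ← Finset.mul_sum, ← Finset.mul_sum, kktObj]
  have hconst : ∑ _i : Fin r, a = (m : ℝ) / K := by
    rw [Finset.sum_const, Finset.card_univ, Fintype.card_fin, nsmul_eq_mul, ha]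
    field_simp
  rw [hsplit fun _ => a, hsplit x, hsum, hconst] at hall
  exact lt_of_add_lt_add_right hall

/-- **Lemma C.2 (KKT lemma):** for `α` large enough, the problem
`min ∑ i [−log(1+αx_i) + (1/K) log(1+Kαx_i)]` subject to `∑ i x_i = m/K`, `x ≥ 0`
has the unique optimal solution `x_i* = m/(rK)` for all `i`. -/
theorem kkt_unique_optimal_solution (m K r : ℕ) (α : ℝ)
    (hK : 2 ≤ K) (hdvd : K ∣ m) (hm : 0 < m)
    (hr : 0 < r) (hrle : r ≤ m / K)
    (hα : 6 * (K : ℝ) ^ ((1 : ℝ) / ((K : ℝ) - 1)) * Real.exp 1 *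
        (1 + 1 / Real.sqrt (K : ℝ)) ^ ((m : ℝ) / ((K : ℝ) - 1)) ≤ α) :
    kktFeasible m K r (fun _ => (m : ℝ) / ((r : ℝ) * (K : ℝ))) ∧
    (∀ x : Fin r → ℝ, kktFeasible m K r x →
      kktObj K r α (fun _ => (m : ℝ) / ((r : ℝ) * (K : ℝ))) ≤ kktObj K r α x) ∧
    (∀ x : Fin r → ℝ, kktFeasible m K r x →
      kktObj K r α x = kktObj K r α (fun _ => (m : ℝ) / ((r : ℝ) * (K : ℝ))) →
      x = fun _ => (m : ℝ) / ((r : ℝ) * (K : ℝ))) := by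
  have hK1 : (1 : ℝ) < K := by exact_mod_cast hK
  have hK0 : (0 : ℝ) < K := by linarith
  have hKsub : (0 : ℝ) < (K : ℝ) - 1 := by linarith
  have hm0 : (0 : ℝ) < m := by exact_mod_cast hm
  have hr0 : (0 : ℝ) < r := by exact_mod_cast hr
  have hbase : (K : ℝ) ^ ((1 : ℝ) / ((K : ℝ) - 1)) * Real.exp 1 ≤ α := by
    have hA : 0 < (K : ℝ) ^ ((1 : ℝ) / ((K : ℝ) - 1)) * Real.exp 1 := by positivity
    have hB : 1 ≤ (1 + 1 / Real.sqrt (K : ℝ)) ^ ((m : ℝ) / ((K : ℝ) - 1)) :=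
      Real.one_le_rpow (le_add_of_nonneg_right (by positivity)) (by positivity)
    nlinarith
  have hα0 : 0 < α := lt_of_lt_of_le (by positivity) hbase
  have hratio : 1 ≤ (m : ℝ) / ((r : ℝ) * (K : ℝ)) := by
    rw [one_le_div (by positivity)]
    exact_mod_cast (Nat.le_div_iff_mul_le (by omega)).1 hrle
  have hlog : ((K : ℝ) - 1) + Real.log K ≤
      ((K : ℝ) - 1) * Real.log (α * ((m : ℝ) / ((r : ℝ) * (K : ℝ)))) := by
    have h := Real.log_le_log (by positivity)
      (hbase.trans (le_mul_of_one_le_right hα0.le hratio))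
    rw [Real.log_mul (by positivity) (by positivity), Real.log_rpow hK0, Real.log_exp] at h
    calc ((K : ℝ) - 1) + Real.log K
        = ((K : ℝ) - 1) * (1 / ((K : ℝ) - 1) * Real.log K + 1) := by
          field_simp
          ring
      _ ≤ _ := mul_le_mul_of_nonneg_left h hKsub.le
  refine ⟨⟨?_, fun i => by positivity⟩, fun x hx => ?_, fun x hx heq => ?_⟩
  · rw [Finset.sum_const, Finset.card_univ, Fintype.card_fin, nsmul_eq_mul]
    field_simp
  · by_cases hne : x = fun _ => (m : ℝ) / ((r : ℝ) * (K : ℝ))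
    · rw [hne]
    · exact (kktObj_const_lt hK hm hr hα0 hlog hx hne).le
  · by_contra hne
    exact (kktObj_const_lt hK hm hr hα0 hlog hx hne).ne' heq

end
end

section
/- Let m, K ≥ 2 be integers such that m/K is a positive integer, let r ≤ m/K be a positive integer, and let α > 0 satisfy α ≥ 6 K^{1/(K−1)} exp(1) (1 + 1/√K)^{m/(K−1)}. Then the function h(s) = s·((1/K) log(1 + mα/s) − log(1 + mα/(sK))) is decreasing in s on the interval [1, r]. -/
open BigOperators

noncomputable section

/-- If `y ≥ 6 e k^{1/(k-1)}`, then `(k-1) log(1 + y) ≥ k + log k`. -/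
theorem add_log_le_mul_log_one_add {k a y : ℝ} (hk : 2 ≤ k)
    (ha : 6 * k ^ (1 / (k - 1)) * Real.exp 1 ≤ a) (hy : a ≤ y) :
    k + Real.log k ≤ (k - 1) * Real.log (1 + y) := by
  have hk1 : 0 < k - 1 := by linarith
  have hp : 0 < k ^ (1 / (k - 1)) := Real.rpow_pos_of_pos (by linarith) _
  have h6 : 1 ≤ Real.log 6 := by
    rw [Real.le_log_iff_exp_le (by norm_num)]
    linarith [Real.exp_one_lt_d9]
  have hlog : Real.log (6 * k ^ (1 / (k - 1)) * Real.exp 1)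
      = Real.log 6 + 1 / (k - 1) * Real.log k + 1 := by
    rw [Real.log_mul (by positivity) (Real.exp_pos 1).ne', Real.log_mul (by norm_num) hp.ne',
      Real.log_rpow (by linarith), Real.log_exp]
  have hmono : Real.log (6 * k ^ (1 / (k - 1)) * Real.exp 1) ≤ Real.log (1 + y) :=
    Real.log_le_log (by positivity) (by linarith)
  have hmul := mul_le_mul_of_nonneg_left hmono hk1.le
  have hcancel : (k - 1) * (1 / (k - 1) * Real.log k) = Real.log k := by field_simp
  rw [hlog, mul_add, mul_add, hcancel] at hmul
  nlinarith [mul_le_mul_of_nonneg_left h6 hk1.le]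

/-- The derivative of `s ↦ s log(1 + c/s)`. -/
theorem hasDerivAt_mul_log_one_add_div {c s : ℝ} (hc : 0 ≤ c) (hs : 0 < s) :
    HasDerivAt (fun t : ℝ => t * Real.log (1 + c / t))
      (Real.log (1 + c / s) - c / (s + c)) s := by
  have hpos : 0 < 1 + c / s := by positivity
  have hdiv : HasDerivAt (fun t : ℝ => 1 + c / t) (-c / s ^ 2) s := by
    simpa [div_eq_mul_inv, neg_mul, mul_neg] using
      ((hasDerivAt_inv hs.ne').const_mul c).const_add 1
  refine ((hasDerivAt_id s).mul (hdiv.log hpos.ne')).congr_deriv ?_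
  have hsc : s + c ≠ 0 := by positivity
  simp only [id]
  field_simp
  ring

/-- `s ((1/k) log(1 + c/s) - log(1 + c/(sk)))` is antitone where `c/(sk)` is large. -/
theorem antitoneOn_mul_log_sub_log {k c a R : ℝ} (hk : 2 ≤ k) (hc : 0 ≤ c)
    (ha : 6 * k ^ (1 / (k - 1)) * Real.exp 1 ≤ a) (hR : R * k * a ≤ c) :
    AntitoneOn
      (fun s : ℝ => s * ((1 / k) * Real.log (1 + c / s) - Real.log (1 + c / (s * k))))
      (Set.Icc 1 R) := by
  have hk0 : 0 < k := by linarith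
  have hp : 0 < k ^ (1 / (k - 1)) := Real.rpow_pos_of_pos hk0 _
  have ha0 : 0 < a := lt_of_lt_of_le (by positivity) ha
  have hderiv : ∀ s : ℝ, 0 < s → HasDerivAt
      (fun s : ℝ => s * ((1 / k) * Real.log (1 + c / s) - Real.log (1 + c / (s * k))))
      (1 / k * (Real.log (1 + c / s) - c / (s + c))
        - (Real.log (1 + c / k / s) - c / k / (s + c / k))) s := by
    intro s hs
    refine (((hasDerivAt_mul_log_one_add_div hc hs).const_mul (1 / k)).sub
      (hasDerivAt_mul_log_one_add_div (c := c / k) (by positivity) hs)).congr_of_eventuallyEq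
      (.of_forall fun t => ?_)
    simp only [Pi.sub_apply]
    rw [div_div, mul_comm k t]
    ring
  refine antitoneOn_of_hasDerivWithinAt_nonpos (convex_Icc 1 R)
    (fun s hs => (hderiv s (by linarith [hs.1])).continuousAt.continuousWithinAt)
    (fun s hs => (hderiv s ?_).hasDerivWithinAt) (fun s hs => ?_)
  · rw [interior_Icc] at hs
    linarith [hs.1]
  · rw [interior_Icc] at hs
    have hs0 : 0 < s := by linarith [hs.1]
    have hy : a ≤ c / k / s := by
      rw [div_div, le_div_iff₀ (by positivity)]
      have := mul_le_mul_of_nonneg_right hs.2.le (mul_pos hk0 ha0).le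
      linarith
    have hkey := add_log_le_mul_log_one_add hk ha hy
    have hy0 : 0 < c / k / s := ha0.trans_le hy
    have hlog : Real.log (1 + c / s) ≤ Real.log k + Real.log (1 + c / k / s) := by
      rw [← Real.log_mul hk0.ne' (by positivity)]
      refine Real.log_le_log (by positivity) ?_
      have : k * (1 + c / k / s) = k + c / s := by field_simp
      linarith
    have hfrac : c / k / (s + c / k) ≤ 1 := by
      rw [div_le_one (by positivity)]
      linarith
    have hfrac' : 0 ≤ c / (s + c) := by positivity
    have hmain : 1 / k * (Real.log (1 + c / s) - c / (s + c)) ≤ Real.log (1 + c / k / s) - 1 := by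
      rw [one_div_mul_eq_div, div_le_iff₀ hk0]
      linarith
    linarith

/-- **Lemma C.3:** for `α` large enough, the function
`h(s) = s ((1/K) log(1 + mα/s) − log(1 + mα/(sK)))` is decreasing on `[1, r]`. -/
theorem h_antitone_on_Icc (m K r : ℕ) (α : ℝ)
    (hK : 2 ≤ K) (hdvd : K ∣ m) (hm : 0 < m)
    (hr : 0 < r) (hrle : r ≤ m / K)
    (hα : 6 * (K : ℝ) ^ ((1 : ℝ) / ((K : ℝ) - 1)) * Real.exp 1 *
        (1 + 1 / Real.sqrt (K : ℝ)) ^ ((m : ℝ) / ((K : ℝ) - 1)) ≤ α) :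
    AntitoneOn
      (fun s : ℝ =>
        s * ((1 / (K : ℝ)) * Real.log (1 + (m : ℝ) * α / s)
          - Real.log (1 + (m : ℝ) * α / (s * (K : ℝ)))))
      (Set.Icc 1 (r : ℝ)) := by
  have hk : (2 : ℝ) ≤ K := by exact_mod_cast hK
  have hp : 0 < (K : ℝ) ^ ((1 : ℝ) / ((K : ℝ) - 1)) := Real.rpow_pos_of_pos (by linarith) _
  have hone : 1 ≤ (1 + 1 / Real.sqrt (K : ℝ)) ^ ((m : ℝ) / ((K : ℝ) - 1)) :=
    Real.one_le_rpow (le_add_of_nonneg_right (by positivity))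
      (div_nonneg (Nat.cast_nonneg m) (by linarith))
  have ha : 6 * (K : ℝ) ^ ((1 : ℝ) / ((K : ℝ) - 1)) * Real.exp 1 ≤ α :=
    (le_mul_of_one_le_right (by positivity) hone).trans hα
  have ha0 : 0 ≤ α := le_trans (by positivity) ha
  have hrK : (r : ℝ) * K ≤ m := by
    exact_mod_cast (Nat.mul_le_mul_right K hrle).trans (Nat.div_mul_le_self m K)
  exact antitoneOn_mul_log_sub_log hk (by positivity) ha (mul_le_mul_of_nonneg_right hrK ha0)

end
end

section
/- Let d, K be positive integers, m_1, …, m_K positive integers with m = Σ_k m_k, ε > 0, α = d/(mε²), α_k = d/(m_k ε²), and suppose 0 < λ ≤ d(√(m/m_max) − 1)/(m(√(m/m_max) + 1)ε²). Then for every k ∈ [K], the quantity η_k := (α_k − α) − λ(m/m_k + 1) satisfies η_k > 0 and η_k² − 4λ²·(m/m_k) ≥ 0; consequently the quadratic equation λα_k x² − η_k x + λ/α = 0 has two positive real roots x = (η_k ± √(η_k² − 4λ²m/m_k))/(2λα_k). -/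
open Matrix BigOperators Finset

noncomputable section

/-- A quadratic `a x² - b x + c` with positive coefficients and nonnegative discriminant has
two positive roots, given by the quadratic formula. -/
theorem quadratic_roots_pos {a b c D : ℝ} (ha : 0 < a) (hb : 0 < b) (hc : 0 < c)
    (hD : 0 ≤ D) (hdisc : D = b ^ 2 - 4 * a * c) :
    (0 < (b + √D) / (2 * a) ∧ 0 < (b - √D) / (2 * a)) ∧
      ∀ x : ℝ, (x = (b + √D) / (2 * a) ∨ x = (b - √D) / (2 * a)) → a * x ^ 2 - b * x + c = 0 := by
  have hlt : √D < b := by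
    rw [Real.sqrt_lt' hb]
    have := mul_pos ha hc
    linarith
  have hsq := Real.mul_self_sqrt hD
  refine ⟨⟨by positivity, div_pos (sub_pos.2 hlt) (by positivity)⟩, fun x hx => ?_⟩
  have hroot := (quadratic_eq_zero_iff (a := a) (b := -b) (c := c) (s := √D) ha.ne'
    (by rw [hsq, hdisc, discrim]; ring) x).2 (by simpa using hx)
  linarith

/-- If `λ (s + 1) ≤ a (s - 1)`, then `2 λ s ≤ (a s² - a) - λ (s² + 1)`. -/
theorem two_mul_mul_le_of_mul_add_one_le {a s l : ℝ} (hs : 0 ≤ s)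
    (h : l * (s + 1) ≤ a * (s - 1)) :
    2 * l * s ≤ (a * s ^ 2 - a) - l * (s ^ 2 + 1) := by
  nlinarith [mul_le_mul_of_nonneg_right h (by linarith : 0 ≤ s + 1)]

theorem lamBound_eq (d : ℕ) {K : ℕ} (mk : Fin K → ℕ) (ε : ℝ) :
    lamBound d mk ε = alph d mk ε *
      ((√((mTot mk : ℝ) / ((Finset.univ.sup mk : ℕ) : ℝ)) - 1) /
        (√((mTot mk : ℝ) / ((Finset.univ.sup mk : ℕ) : ℝ)) + 1)) := by
  rw [lamBound, alph, div_mul_div_comm]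
  congr 1
  ring

theorem alphK_eq (d : ℕ) {K : ℕ} (mk : Fin K → ℕ) (ε : ℝ) (k : Fin K)
    (hm : (mTot mk : ℝ) ≠ 0) :
    alphK d mk ε k = alph d mk ε * ((mTot mk : ℝ) / (mk k : ℝ)) := by
  rw [alphK, alph, div_mul_div_comm, mul_right_comm, mul_comm (d : ℝ), mul_assoc,
    mul_div_mul_left _ _ hm]

theorem lam_mul_sqrt_add_one_le (d : ℕ) {K : ℕ} (mk : Fin K → ℕ) (ε lam : ℝ) (k : Fin K)
    (hk : 0 < mk k) (hlam : lam ≤ lamBound d mk ε) :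
    lam * (√((mTot mk : ℝ) / (mk k : ℝ)) + 1) ≤
      alph d mk ε * (√((mTot mk : ℝ) / (mk k : ℝ)) - 1) := by
  have hts : √((mTot mk : ℝ) / ((Finset.univ.sup mk : ℕ) : ℝ)) ≤
      √((mTot mk : ℝ) / (mk k : ℝ)) := by
    have hle : mk k ≤ Finset.univ.sup mk := Finset.le_sup (Finset.mem_univ k)
    gcongr
  rw [lamBound_eq] at hlam
  set t := √((mTot mk : ℝ) / ((Finset.univ.sup mk : ℕ) : ℝ))
  set s := √((mTot mk : ℝ) / (mk k : ℝ))
  have ht : 0 ≤ t := Real.sqrt_nonneg _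
  have hs : 0 ≤ s := Real.sqrt_nonneg _
  have ha : 0 ≤ alph d mk ε := by unfold alph; positivity
  have hmono : (t - 1) / (t + 1) ≤ (s - 1) / (s + 1) := by
    rw [div_le_div_iff₀ (by positivity) (by positivity)]
    linarith
  rw [← le_div_iff₀ (by positivity), mul_div_assoc]
  exact hlam.trans (mul_le_mul_of_nonneg_left hmono ha)

/-- **Positivity of `η_k` and of the roots of the singular-value quadratic:** under the
bound on `λ`, for every `k` one has `η_k > 0` and `η_k² − 4λ²(m/m_k) ≥ 0`, and the
quadratic `λα_k x² − η_k x + λ/α = 0` has the two positive real roots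
`x = (η_k ± √(η_k² − 4λ²m/m_k)) / (2λα_k)`. -/
theorem etaK_pos_and_quadratic_roots (d K : ℕ) (mk : Fin K → ℕ) (ε lam : ℝ)
    (hmk : ∀ k, 0 < mk k) (hε : 0 < ε)
    (hlam0 : 0 < lam) (hlam : lam ≤ lamBound d mk ε) :
    ∀ k : Fin K,
      0 < etaK d mk ε lam k ∧
      0 ≤ etaK d mk ε lam k ^ 2 - 4 * lam ^ 2 * ((mTot mk : ℝ) / (mk k : ℝ)) ∧
      (0 < (etaK d mk ε lam k
          + Real.sqrt (etaK d mk ε lam k ^ 2 - 4 * lam ^ 2 * ((mTot mk : ℝ) / (mk k : ℝ))))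
          / (2 * lam * alphK d mk ε k) ∧
        0 < (etaK d mk ε lam k
          - Real.sqrt (etaK d mk ε lam k ^ 2 - 4 * lam ^ 2 * ((mTot mk : ℝ) / (mk k : ℝ))))
          / (2 * lam * alphK d mk ε k)) ∧
      (∀ x : ℝ,
        (x = (etaK d mk ε lam k
            + Real.sqrt (etaK d mk ε lam k ^ 2 - 4 * lam ^ 2 * ((mTot mk : ℝ) / (mk k : ℝ))))
            / (2 * lam * alphK d mk ε k) ∨
         x = (etaK d mk ε lam k
            - Real.sqrt (etaK d mk ε lam k ^ 2 - 4 * lam ^ 2 * ((mTot mk : ℝ) / (mk k : ℝ))))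
            / (2 * lam * alphK d mk ε k)) →
        lam * alphK d mk ε k * x ^ 2 - etaK d mk ε lam k * x + lam / alph d mk ε = 0) := by
  intro k
  have hk : 0 < (mk k : ℝ) := by exact_mod_cast hmk k
  have hm : 0 < (mTot mk : ℝ) := by
    exact_mod_cast (hmk k).trans_le (Finset.single_le_sum_of_canonicallyOrdered (Finset.mem_univ k))
  have hr : 0 < (mTot mk : ℝ) / (mk k : ℝ) := div_pos hm hk
  have ha : 0 < alph d mk ε := by
    refine lt_of_le_of_ne (by unfold alph; positivity) fun h => ?_
    rw [lamBound_eq, ← h, zero_mul] at hlam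
    exact hlam0.not_ge hlam
  have hA := alphK_eq d mk ε k hm.ne'
  have hApos : 0 < alphK d mk ε k := hA ▸ mul_pos ha hr
  have hs : 0 < √((mTot mk : ℝ) / (mk k : ℝ)) := Real.sqrt_pos.2 hr
  have hη : 2 * lam * √((mTot mk : ℝ) / (mk k : ℝ)) ≤ etaK d mk ε lam k := by
    have h := two_mul_mul_le_of_mul_add_one_le hs.le
      (lam_mul_sqrt_add_one_le d mk ε lam k (hmk k) hlam)
    rwa [Real.sq_sqrt hr.le, ← hA] at h
  have hηpos : 0 < etaK d mk ε lam k := lt_of_lt_of_le (by positivity) hη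
  have hD : 0 ≤ etaK d mk ε lam k ^ 2 - 4 * lam ^ 2 * ((mTot mk : ℝ) / (mk k : ℝ)) := by
    have h := pow_le_pow_left₀ (by positivity) hη 2
    rw [mul_pow, Real.sq_sqrt hr.le] at h
    linarith
  refine ⟨hηpos, hD, ?_⟩
  rw [mul_assoc 2 lam]
  refine quadratic_roots_pos (mul_pos hlam0 hApos) hηpos (div_pos hlam0 ha) hD ?_
  rw [hA]
  field_simp


end
end
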